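/- arXiv:0803.1652 — 7 statements merged into one kernel-verified Lean document; each statement's English description precedes it below -/
import Mathlib

section
/- Let T be a bounded self-adjoint invertible operator on a complex Hilbert space H. Then the operators (1/π) ∫_{−R}^{R} (T − iη)⁻¹ dη (Bochner integral of the operator-valued function η ↦ (T − iη·Id)⁻¹ over the symmetric interval [−R, R]) converge in operator norm, as R → ∞, to sgn(T), the continuous functional calculus of T applied to the sign function. -/
open MeasureTheory Filter

/-- The symmetric truncated integral of `η ↦ (x - iη)⁻¹` is an arctangent. -/
lemma integral_inv_ofReal_sub_mul_I {x : ℝ} (hx : x ≠ 0) (R : ℝ) :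
    ∫ η in (-R)..R, ((x : ℂ) - (η : ℂ) * Complex.I)⁻¹ = ((2 * Real.arctan (R / x) : ℝ) : ℂ) := by
  have hpos (η : ℝ) : 0 < x ^ 2 + η ^ 2 := by positivity
  have hne (η : ℝ) : (x : ℂ) - (η : ℂ) * Complex.I ≠ 0 := fun h ↦
    hx (by simpa using congrArg Complex.re h)
  have hderiv (η : ℝ) : HasDerivAt
      (fun t : ℝ ↦ ((Real.arctan (t / x) : ℝ) : ℂ)
        + ((Real.log (x ^ 2 + t ^ 2) / 2 : ℝ) : ℂ) * Complex.I)
      ((x : ℂ) - (η : ℂ) * Complex.I)⁻¹ η := by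
    have h₁ := (((hasDerivAt_id η).div_const x).arctan).ofReal_comp
    have h₂ := (((((hasDerivAt_id η).pow 2).const_add (x ^ 2)).log (hpos η).ne').div_const
      2).ofReal_comp.mul_const Complex.I
    refine (h₁.add h₂).congr_deriv (eq_inv_of_mul_eq_one_left ?_)
    have hpos' := (hpos η).ne'
    have hre : 1 / (1 + (id η / x) ^ 2) * (1 / x) = x / (x ^ 2 + η ^ 2) := by
      simp only [id]
      field_simp
    have him : (((2 : ℕ) : ℝ) * id η ^ (2 - 1) * 1) / (x ^ 2 + (id ^ 2) η) / 2
        = η / (x ^ 2 + η ^ 2) := by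
      simp
      field_simp
    rw [hre, him]
    have hposC : (x : ℂ) ^ 2 + (η : ℂ) ^ 2 ≠ 0 := mod_cast hpos'
    push_cast
    field_simp
    linear_combination -(η : ℂ) ^ 2 * Complex.I_sq
  rw [intervalIntegral.integral_eq_sub_of_hasDerivAt (fun η _ ↦ hderiv η)]
  · simp only [neg_div, Real.arctan_neg, neg_sq]
    push_cast
    ring
  · refine Continuous.intervalIntegrable ?_ _ _
    exact Continuous.inv₀ (by fun_prop) hne

lemma abs_two_div_pi_mul_arctan_sub_sign_le {x R : ℝ} (hx : x ≠ 0) (hR : 0 < R) :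
    |2 / Real.pi * Real.arctan (R / x) - Real.sign x| ≤ |x| / R := by
  have key : ∀ y : ℝ, 0 < y → |2 / Real.pi * Real.arctan (R / y) - 1| ≤ y / R := by
    intro y hy
    have h₁ : Real.arctan (R / y) = Real.pi / 2 - Real.arctan (y / R) := by
      rw [← Real.arctan_inv_of_pos (by positivity), inv_div]
    have h₂ : 0 ≤ Real.arctan (y / R) := Real.arctan_nonneg.2 (by positivity)
    have h₃ : Real.arctan (y / R) ≤ y / R := by
      simpa only [Real.tan_arctan] using Real.le_tan h₂ (Real.arctan_lt_pi_div_two _)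
    have h₄ : 2 / Real.pi ≤ 1 := (div_le_one Real.pi_pos).2 Real.two_le_pi
    have h₅ : 2 / Real.pi * Real.arctan (R / y) - 1 = -(2 / Real.pi * Real.arctan (y / R)) := by
      rw [h₁]
      field_simp
      ring
    rw [h₅, abs_neg, abs_of_nonneg (by positivity)]
    exact (mul_le_of_le_one_left h₂ h₄).trans h₃
  rcases hx.lt_or_gt with h | h
  · rw [Real.sign_of_neg h, abs_of_neg h, ← abs_neg]
    convert key (-x) (by linarith) using 2
    rw [div_neg, Real.arctan_neg]
    ring
  · rw [Real.sign_of_pos h, abs_of_pos h]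
    exact key x h

lemma IsSelfAdjoint.ofReal_re_eq_of_mem_spectrum {A : Type*} [CStarAlgebra A] {a : A}
    (ha : IsSelfAdjoint a) {z : ℂ} (hz : z ∈ spectrum ℂ a) : (z.re : ℂ) = z :=
  (ha.mem_spectrum_eq_re hz).symm

lemma IsSelfAdjoint.re_ne_zero_of_mem_spectrum {A : Type*} [CStarAlgebra A] {a : A}
    (ha : IsSelfAdjoint a) (hu : IsUnit a) {z : ℂ} (hz : z ∈ spectrum ℂ a) : z.re ≠ 0 := by
  intro h
  rw [← ha.ofReal_re_eq_of_mem_spectrum hz, h, Complex.ofReal_zero] at hz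
  exact spectrum.zero_notMem ℂ hu hz

lemma IsSelfAdjoint.sub_mul_I_ne_zero_of_mem_spectrum {A : Type*} [CStarAlgebra A] {a : A}
    (ha : IsSelfAdjoint a) (hu : IsUnit a) (η : ℝ) {z : ℂ} (hz : z ∈ spectrum ℂ a) :
    z - (η : ℂ) * Complex.I ≠ 0 := fun h ↦
  ha.re_ne_zero_of_mem_spectrum hu hz (by simpa using congrArg Complex.re h)

/-- The resolvent of an invertible self-adjoint element on the imaginary axis, as a continuous
functional calculus. -/
lemma IsSelfAdjoint.inverse_sub_mul_I_eq_cfc {A : Type*} [CStarAlgebra A] {a : A}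
    (ha : IsSelfAdjoint a) (hu : IsUnit a) (η : ℝ) :
    Ring.inverse (a - ((η : ℂ) * Complex.I) • (1 : A))
      = cfc (fun z : ℂ ↦ (z - (η : ℂ) * Complex.I)⁻¹) a := by
  have hn : IsStarNormal a := ha.isStarNormal
  rw [cfc_inv (fun z : ℂ ↦ z - (η : ℂ) * Complex.I) a
      (fun z hz ↦ ha.sub_mul_I_ne_zero_of_mem_spectrum hu η hz),
    cfc_sub (fun z : ℂ ↦ z) (fun _ ↦ (η : ℂ) * Complex.I) a, cfc_id' ℂ a, cfc_const _ a,
    Algebra.algebraMap_eq_smul_one]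

/-- The truncated integral of the resolvent along the imaginary axis, as a continuous functional
calculus. -/
lemma IsSelfAdjoint.integral_inverse_sub_mul_I_eq_cfc {A : Type*} [CStarAlgebra A] {a : A}
    (ha : IsSelfAdjoint a) (hu : IsUnit a) {R : ℝ} (hR : 0 ≤ R) :
    ∫ η in (-R)..R, Ring.inverse (a - ((η : ℂ) * Complex.I) • (1 : A))
      = cfc (fun z : ℂ ↦ ((2 * Real.arctan (R / z.re) : ℝ) : ℂ)) a := by
  have hn : IsStarNormal a := ha.isStarNormal
  have hcont (s : Set ℝ) : ContinuousOn
      (Function.uncurry fun (η : ℝ) (z : ℂ) ↦ (z - (η : ℂ) * Complex.I)⁻¹)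
      (s ×ˢ spectrum ℂ a) :=
    ContinuousOn.inv₀ (by fun_prop) fun p hp ↦ ha.sub_mul_I_ne_zero_of_mem_spectrum hu p.1 hp.2
  obtain ⟨C, hC⟩ := (isCompact_Icc.prod (spectrum.isCompact a)).exists_bound_of_continuousOn
    (hcont (Set.Icc (-R) R))
  simp_rw [ha.inverse_sub_mul_I_eq_cfc hu]
  rw [intervalIntegral.integral_of_le (by linarith),
    ← cfc_setIntegral measurableSet_Ioc _ (fun _ ↦ C) a (hcont _)
      (ae_restrict_of_forall_mem measurableSet_Ioc fun η hη z hz ↦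
        hC (η, z) ⟨Set.Ioc_subset_Icc_self hη, hz⟩)
      (integrable_const C).hasFiniteIntegral]
  refine cfc_congr fun z hz ↦ ?_
  rw [← integral_inv_ofReal_sub_mul_I (ha.re_ne_zero_of_mem_spectrum hu hz),
    intervalIntegral.integral_of_le (by linarith), ha.ofReal_re_eq_of_mem_spectrum hz]

/-- For a bounded self-adjoint invertible operator `T` on a complex Hilbert
space, the principal-value integrals `(1/π) ∫_{−R}^{R} (T − iη)⁻¹ dη` converge in operator norm,
as `R → ∞`, to `sgn(T)` (continuous functional calculus of the sign function). -/
theorem sgn_eq_principal_value_resolvent_integral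
    {H : Type*} [NormedAddCommGroup H] [InnerProductSpace ℂ H] [CompleteSpace H]
    (T : H →L[ℂ] H) (hT : IsSelfAdjoint T) (hTinv : IsUnit T) :
    Tendsto
      (fun R : ℝ => (1 / Real.pi) •
        ∫ η in (-R)..R, Ring.inverse (T - ((η : ℂ) * Complex.I) • (1 : H →L[ℂ] H)))
      atTop (nhds (cfc Real.sign T)) := by
  have hcont (R : ℝ) : ContinuousOn (fun z : ℂ ↦ ((2 * Real.arctan (R / z.re) : ℝ) : ℂ))
      (spectrum ℂ T) := by
    have : ContinuousOn (fun z : ℂ ↦ R / z.re) (spectrum ℂ T) :=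
      continuousOn_const.div Complex.continuous_re.continuousOn
        fun z hz ↦ hT.re_ne_zero_of_mem_spectrum hTinv hz
    fun_prop
  rw [cfc_real_eq_complex Real.sign hT]
  have hlim : Tendsto (fun R : ℝ ↦ cfc
      (fun z : ℂ ↦ (1 / Real.pi) • ((2 * Real.arctan (R / z.re) : ℝ) : ℂ)) T) atTop
      (nhds (cfc (fun z : ℂ ↦ (Real.sign z.re : ℂ)) T)) := by
    refine tendsto_cfc_fun ?_ (.of_forall fun R ↦ (hcont R).const_smul (1 / Real.pi))
    obtain ⟨C, hC⟩ := (spectrum.isCompact T).exists_bound_of_continuousOn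
      Complex.continuous_re.continuousOn
    rw [Metric.tendstoUniformlyOn_iff]
    intro ε hε
    filter_upwards [eventually_gt_atTop 0,
      (tendsto_const_nhds.div_atTop tendsto_id : Tendsto (fun R : ℝ ↦ C / R) atTop
        (nhds 0)).eventually_lt_const hε] with R hR hRε z hz
    calc dist (Real.sign z.re : ℂ) ((1 / Real.pi) • ((2 * Real.arctan (R / z.re) : ℝ) : ℂ))
        = |2 / Real.pi * Real.arctan (R / z.re) - Real.sign z.re| := by
          rw [dist_comm, dist_eq_norm, Complex.real_smul, ← Complex.ofReal_mul,
            ← Complex.ofReal_sub, Complex.norm_real, Real.norm_eq_abs]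
          ring_nf
      _ ≤ |z.re| / R :=
          abs_two_div_pi_mul_arctan_sub_sign_le (hT.re_ne_zero_of_mem_spectrum hTinv hz) hR
      _ ≤ C / R := by gcongr; exact hC z hz
      _ < ε := hRε
  refine hlim.congr' ?_
  filter_upwards [eventually_ge_atTop 0] with R hR
  rw [hT.integral_inverse_sub_mul_I_eq_cfc hTinv hR, cfc_smul _ _ _ (hcont R)]
end

section
/- Let T be a bounded self-adjoint invertible operator on a complex Hilbert space H. Then for every φ ∈ H one has ∫_ℝ ‖ |T|^{1/2} (T − iη)⁻¹ φ ‖² dη = π ‖φ‖². -/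
open MeasureTheory

theorem integral_abs_div_sq_add_sq {x : ℝ} (hx : x ≠ 0) :
    ∫ η : ℝ, |x| / (x ^ 2 + η ^ 2) = Real.pi := by
  have h (η : ℝ) : |x| / (x ^ 2 + η ^ 2) = |x|⁻¹ * (1 + (η / x) ^ 2)⁻¹ := by
    have : |x| ≠ 0 := abs_ne_zero.2 hx
    rw [← sq_abs x, div_pow, ← sq_abs x]
    field_simp
  simp_rw [h]
  rw [integral_const_mul, Measure.integral_comp_div (fun y : ℝ => (1 + y ^ 2)⁻¹),
    integral_univ_inv_one_add_sq, smul_eq_mul, inv_mul_cancel_left₀ (abs_ne_zero.2 hx)]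

theorem integrable_div_sq_add_sq (M : ℝ) {δ : ℝ} (hδ : δ ≠ 0) :
    Integrable fun η : ℝ => M / (δ ^ 2 + η ^ 2) := by
  have h (η : ℝ) : M / (δ ^ 2 + η ^ 2) = M / δ ^ 2 * (1 + (η / δ) ^ 2)⁻¹ := by
    field_simp
  simp_rw [h]
  exact (integrable_inv_one_add_sq.comp_div hδ).const_mul _

theorem exists_le_abs_le_of_mem_spectrum {A : Type*} [NormedRing A] [NormedAlgebra ℝ A]
    [CompleteSpace A] {a : A} (ha : IsUnit a) :
    ∃ δ M : ℝ, 0 < δ ∧ ∀ x ∈ spectrum ℝ a, δ ≤ |x| ∧ |x| ≤ M := by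
  obtain ⟨δ, hδ, hball⟩ := Metric.isOpen_iff.1 (spectrum.isClosed (𝕜 := ℝ) a).isOpen_compl 0
    (spectrum.zero_notMem ℝ ha)
  obtain ⟨M, hM⟩ := (spectrum.isCompact (𝕜 := ℝ) a).isBounded.exists_norm_le
  refine ⟨δ, M, hδ, fun x hx => ⟨?_, hM x hx⟩⟩
  by_contra! h
  exact hball (by simpa using h) hx

section CStarAlgebra

variable {A : Type*} [CStarAlgebra A] {a : A}

theorem continuousOn_abs_div_sq_add_sq (ha : IsUnit a) :
    ContinuousOn (Function.uncurry fun η x : ℝ => |x| / (x ^ 2 + η ^ 2))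
      (Set.univ ×ˢ spectrum ℝ a) := by
  refine ContinuousOn.div (by fun_prop) (by fun_prop) fun p hp => ?_
  have : p.2 ≠ 0 := spectrum.ne_zero_of_mem_of_unit (a := ha.unit) hp.2
  positivity

theorem norm_abs_div_sq_add_sq_le {δ M η x : ℝ} (hδ : 0 < δ) (h₁ : δ ≤ |x|) (h₂ : |x| ≤ M) :
    ‖|x| / (x ^ 2 + η ^ 2)‖ ≤ M / (δ ^ 2 + η ^ 2) := by
  rw [Real.norm_of_nonneg (by positivity), ← sq_abs x]
  have : 0 ≤ M := (abs_nonneg x).trans h₂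
  gcongr

theorem integrable_cfc_abs_div_sq_add_sq (ha : IsSelfAdjoint a) (hu : IsUnit a) :
    Integrable fun η : ℝ => cfc (fun x : ℝ => |x| / (x ^ 2 + η ^ 2)) a := by
  obtain ⟨δ, M, hδ, h⟩ := exists_le_abs_le_of_mem_spectrum hu
  exact integrable_cfc _ _ a (continuousOn_abs_div_sq_add_sq hu)
    (.of_forall fun _ x hx => norm_abs_div_sq_add_sq_le hδ (h x hx).1 (h x hx).2)
    (integrable_div_sq_add_sq M hδ.ne').hasFiniteIntegral

theorem integral_cfc_abs_div_sq_add_sq (ha : IsSelfAdjoint a) (hu : IsUnit a) :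
    ∫ η : ℝ, cfc (fun x : ℝ => |x| / (x ^ 2 + η ^ 2)) a = algebraMap ℝ A Real.pi := by
  obtain ⟨δ, M, hδ, h⟩ := exists_le_abs_le_of_mem_spectrum hu
  rw [← cfc_integral _ _ a (continuousOn_abs_div_sq_add_sq hu)
    (.of_forall fun _ x hx => norm_abs_div_sq_add_sq_le hδ (h x hx).1 (h x hx).2)
    (integrable_div_sq_add_sq M hδ.ne').hasFiniteIntegral, ← cfc_const Real.pi a]
  exact cfc_congr fun x hx =>
    integral_abs_div_sq_add_sq (abs_pos.1 (hδ.trans_le (h x hx).1))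

theorem cfc_inv_sq_add_sq_mul (ha : IsSelfAdjoint a) (hu : IsUnit a) (η : ℝ) :
    cfc (fun x : ℝ => (x ^ 2 + η ^ 2)⁻¹) a * ((a + ((η : ℂ) * Complex.I) • (1 : A)) *
      (a - ((η : ℂ) * Complex.I) • (1 : A))) = 1 := by
  have hne (x) (hx : x ∈ spectrum ℝ a) : x ^ 2 + η ^ 2 ≠ 0 := by
    have : x ≠ 0 := spectrum.ne_zero_of_mem_of_unit (a := hu.unit) hx
    positivity
  have hq : cfc (fun x : ℝ => x ^ 2 + η ^ 2) a =
      (a + ((η : ℂ) * Complex.I) • (1 : A)) * (a - ((η : ℂ) * Complex.I) • (1 : A)) := by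
    have hη : (η : ℂ) * Complex.I * (η * Complex.I) = -((η ^ 2 : ℝ) : ℂ) := by
      push_cast
      linear_combination (η : ℂ) ^ 2 * Complex.I_sq
    rw [cfc_add (a := a) (fun x : ℝ => x ^ 2) (fun _ => η ^ 2), cfc_pow_id a 2, cfc_const _ a,
      Algebra.algebraMap_eq_smul_one, ← Complex.coe_smul, ← neg_neg (((η ^ 2 : ℝ) : ℂ)), ← hη,
      add_mul, mul_sub, mul_sub, smul_mul_smul_comm, mul_smul_one, smul_one_mul, one_mul, neg_smul]
    noncomm_ring
  rw [← hq, ← cfc_mul _ _ a (by fun_prop (disch := exact hne)) (by fun_prop), ← cfc_one ℝ a]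
  exact cfc_congr fun x hx => inv_mul_cancel₀ (hne x hx)

/-- Rationalizing the denominator of the resolvent of a self-adjoint element. -/
theorem inverse_sub_mul_I_smul_one (ha : IsSelfAdjoint a) (hu : IsUnit a) (η : ℝ) :
    Ring.inverse (a - ((η : ℂ) * Complex.I) • (1 : A)) =
      cfc (fun x : ℝ => (x ^ 2 + η ^ 2)⁻¹) a * (a + ((η : ℂ) * Complex.I) • (1 : A)) := by
  have h := cfc_inv_sq_add_sq_mul ha hu η
  set b := cfc (fun x : ℝ => (x ^ 2 + η ^ 2)⁻¹) a with hb
  set c := ((η : ℂ) * Complex.I) • (1 : A) with hc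
  have hac : Commute a c := (Commute.one_right a).smul_right _
  have hbc : Commute b c := (Commute.one_right b).smul_right _
  have hba : Commute b a := by simpa [cfc_id' ℝ a] using cfc_commute_cfc _ (fun x : ℝ => x) a
  have hcomm : Commute (a - c) (b * (a + c)) :=
    ((hba.sub_right hbc).symm).mul_right
      (((Commute.refl a).sub_left hac.symm).add_right (hac.sub_left (Commute.refl c)))
  have h₁ : b * (a + c) * (a - c) = 1 := by rw [mul_assoc, h]
  exact Ring.inverse_unit ⟨a - c, b * (a + c), hcomm.eq.trans h₁, h₁⟩

theorem star_inverse_mul_cfc_sqrt_abs_sq_mul_inverse (ha : IsSelfAdjoint a) (hu : IsUnit a)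
    (η : ℝ) :
    star (cfc (fun x : ℝ => Real.sqrt |x|) a *
        Ring.inverse (a - ((η : ℂ) * Complex.I) • (1 : A))) *
      (cfc (fun x : ℝ => Real.sqrt |x|) a *
        Ring.inverse (a - ((η : ℂ) * Complex.I) • (1 : A))) =
      cfc (fun x : ℝ => |x| / (x ^ 2 + η ^ 2)) a := by
  have hne (x) (hx : x ∈ spectrum ℝ a) : x ^ 2 + η ^ 2 ≠ 0 := by
    have : x ≠ 0 := spectrum.ne_zero_of_mem_of_unit (a := hu.unit) hx
    positivity
  have hf : cfc (fun x : ℝ => |x| / (x ^ 2 + η ^ 2)) a =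
      cfc (fun x : ℝ => Real.sqrt |x|) a * cfc (fun x : ℝ => Real.sqrt |x|) a *
        cfc (fun x : ℝ => (x ^ 2 + η ^ 2)⁻¹) a := by
    rw [← cfc_mul _ _ a (by fun_prop) (by fun_prop),
      ← cfc_mul _ _ a (by fun_prop) (by fun_prop (disch := exact hne))]
    exact cfc_congr fun x _ => by
      simp only [Real.mul_self_sqrt (abs_nonneg x), div_eq_mul_inv]
  rw [hf, inverse_sub_mul_I_smul_one ha hu]
  have h := cfc_inv_sq_add_sq_mul ha hu η
  have hs : IsSelfAdjoint (cfc (fun x : ℝ => Real.sqrt |x|) a) := cfc_predicate _ a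
  have hb : IsSelfAdjoint (cfc (fun x : ℝ => (x ^ 2 + η ^ 2)⁻¹) a) := cfc_predicate _ a
  have hsb := cfc_commute_cfc (fun x : ℝ => Real.sqrt |x|) (fun x : ℝ => (x ^ 2 + η ^ 2)⁻¹) a
  have hsa : Commute (cfc (fun x : ℝ => Real.sqrt |x|) a) a := by
    simpa [cfc_id' ℝ a] using cfc_commute_cfc _ (fun x : ℝ => x) a
  have hba : Commute (cfc (fun x : ℝ => (x ^ 2 + η ^ 2)⁻¹) a) a := by
    simpa [cfc_id' ℝ a] using cfc_commute_cfc _ (fun x : ℝ => x) a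
  generalize cfc (fun x : ℝ => (x ^ 2 + η ^ 2)⁻¹) a = b at *
  generalize cfc (fun x : ℝ => Real.sqrt |x|) a = s at *
  set c := ((η : ℂ) * Complex.I) • (1 : A) with hc
  have hstar : star c = -c := by simp [hc]
  have hcomm (y : A) : Commute y c := (Commute.one_right y).smul_right _
  have hsub {y : A} (hy : Commute y a) : Commute (a - c) y := (hy.sub_right (hcomm y)).symm
  have hadd : Commute (a - c) (a + c) :=
    hsub ((Commute.refl a).add_left (hcomm a).symm)
  calc star (s * (b * (a + c))) * (s * (b * (a + c)))
      = (a - c) * (b * s * s * b * (a + c)) := by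
        simp only [star_mul, star_add, ha.star_eq, hb.star_eq, hs.star_eq, hstar, mul_assoc,
          sub_eq_add_neg]
    _ = b * s * s * b * (a + c) * (a - c) :=
        (((((hsub hba).mul_right (hsub hsa)).mul_right (hsub hsa)).mul_right
          (hsub hba)).mul_right hadd).eq
    _ = b * s * s * (b * ((a + c) * (a - c))) := by simp only [mul_assoc]
    _ = s * s * b := by rw [h, mul_one, ← hsb.eq, mul_assoc, ← hsb.eq, mul_assoc]

end CStarAlgebra

/-- For a bounded self-adjoint invertible operator `T` on a complex Hilbert
space and every `φ ∈ H`: `∫_ℝ ‖ |T|^{1/2} (T − iη)⁻¹ φ ‖² dη = π ‖φ‖²`. -/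
theorem integral_sq_norm_absHalf_resolvent
    {H : Type*} [NormedAddCommGroup H] [InnerProductSpace ℂ H] [CompleteSpace H]
    (T : H →L[ℂ] H) (hT : IsSelfAdjoint T) (hTinv : IsUnit T) (φ : H) :
    ∫ η : ℝ,
        ‖cfc (fun x : ℝ => Real.sqrt |x|) T
          (Ring.inverse (T - ((η : ℂ) * Complex.I) • (1 : H →L[ℂ] H)) φ)‖ ^ 2
      = Real.pi * ‖φ‖ ^ 2 := by
  let L : (H →L[ℂ] H) →L[ℝ] ℝ :=
    Complex.reCLM ∘L ((innerSL ℂ φ ∘L ContinuousLinearMap.apply ℂ H φ).restrictScalars ℝ)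
  have hL (S : H →L[ℂ] H) : L S = (inner ℂ φ (S φ)).re := rfl
  have hpt (η : ℝ) :
      ‖cfc (fun x : ℝ => Real.sqrt |x|) T
          (Ring.inverse (T - ((η : ℂ) * Complex.I) • (1 : H →L[ℂ] H)) φ)‖ ^ 2 =
        L (cfc (fun x : ℝ => |x| / (x ^ 2 + η ^ 2)) T) := by
    rw [← star_inverse_mul_cfc_sqrt_abs_sq_mul_inverse hT hTinv, hL]
    exact (cfc (fun x : ℝ => Real.sqrt |x|) T *
      Ring.inverse (T - ((η : ℂ) * Complex.I) • (1 : H →L[ℂ] H))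
      ).apply_norm_sq_eq_inner_adjoint_right φ
  simp_rw [hpt]
  rw [L.integral_comp_comm (integrable_cfc_abs_div_sq_add_sq hT hTinv),
    integral_cfc_abs_div_sq_add_sq hT hTinv, hL, Algebra.algebraMap_eq_smul_one]
  simp [← Complex.coe_smul, ← Complex.ofReal_pow]
end

section
/- Let δ > 0 and let T be a bounded self-adjoint operator on a complex Hilbert space H whose spectrum is disjoint from the open interval (−δ, δ). Then for every η ∈ ℝ: if |η| ≤ δ then ‖ |T|^{1/2} (T − iη)⁻¹ ‖ ≤ √δ / √(δ² + η²), and if |η| ≥ δ then ‖ |T|^{1/2} (T − iη)⁻¹ ‖ ≤ 1/√(2|η|). -/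
/-- A pointwise bound on the spectrum controls `‖|T|^{1/2} (T - iη)⁻¹‖`. -/
lemma norm_absHalf_resolvent_le {A : Type*} [CStarAlgebra A] {T : A} (hT : IsSelfAdjoint T)
    {η c : ℝ} (hc : 0 ≤ c) (hne : ∀ x ∈ spectrum ℝ T, x ≠ 0)
    (hle : ∀ x ∈ spectrum ℝ T, |x| ≤ c ^ 2 * (x ^ 2 + η ^ 2)) :
    ‖cfc (fun x : ℝ => Real.sqrt |x|) T *
      Ring.inverse (T - ((η : ℂ) * Complex.I) • (1 : A))‖ ≤ c := by
  have hnormal : IsStarNormal T := hT.isStarNormal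
  have hspec : ∀ z ∈ spectrum ℂ T, z = (z.re : ℂ) ∧ z.re ∈ spectrum ℝ T := by
    intro z hz
    have h := hT.mem_spectrum_eq_re hz
    refine ⟨h, ?_⟩
    rw [h] at hz
    exact (spectrum.algebraMap_mem_iff ℂ).mp hz
  have hsub_ne : ∀ z ∈ spectrum ℂ T, z - (η : ℂ) * Complex.I ≠ 0 := by
    intro z hz h
    have hre := congrArg Complex.re h
    simp only [Complex.sub_re, Complex.mul_re, Complex.ofReal_re, Complex.I_re, mul_zero,
      Complex.ofReal_im, Complex.I_im, mul_one, sub_zero, Complex.zero_re] at hre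
    exact hne _ (hspec z hz).2 hre
  have hsub : T - ((η : ℂ) * Complex.I) • (1 : A)
      = cfc (fun z : ℂ => z - (η : ℂ) * Complex.I) T := by
    rw [cfc_sub (fun z : ℂ => z) (fun _ => (η : ℂ) * Complex.I) T, cfc_id' ℂ T hnormal,
      cfc_const _ T hnormal, Algebra.algebraMap_eq_smul_one]
  have hinv : ContinuousOn (fun z : ℂ => (z - (η : ℂ) * Complex.I)⁻¹) (spectrum ℂ T) :=
    ContinuousOn.inv₀ (by fun_prop) hsub_ne
  rw [hsub, ← cfc_inv _ T hsub_ne (by fun_prop) hnormal, cfc_real_eq_complex _ hT,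
    ← cfc_mul _ _ T (by fun_prop) hinv]
  refine norm_cfc_le hc fun z hz => ?_
  obtain ⟨hz_re, hx⟩ := hspec z hz
  have hnorm : ‖z - (η : ℂ) * Complex.I‖ = Real.sqrt (z.re ^ 2 + η ^ 2) := by
    rw [hz_re, Complex.norm_eq_sqrt_sq_add_sq]
    simp
  have hpos : 0 < z.re ^ 2 + η ^ 2 := by
    have := hne _ hx
    positivity
  rw [norm_mul, norm_inv, hnorm, Complex.norm_real, Real.norm_of_nonneg (Real.sqrt_nonneg _),
    ← div_eq_mul_inv, div_le_iff₀ (Real.sqrt_pos.mpr hpos)]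
  calc Real.sqrt |z.re| ≤ Real.sqrt (c ^ 2 * (z.re ^ 2 + η ^ 2)) := Real.sqrt_le_sqrt (hle _ hx)
    _ = c * Real.sqrt (z.re ^ 2 + η ^ 2) := by
      rw [Real.sqrt_mul (sq_nonneg c), Real.sqrt_sq hc]


/-- Let `δ > 0` and let `T` be a bounded self-adjoint operator whose spectrum
is disjoint from `(−δ, δ)`. Then for every `η ∈ ℝ`:
if `|η| ≤ δ` then `‖ |T|^{1/2} (T − iη)⁻¹ ‖ ≤ √δ / √(δ² + η²)`, and
if `|η| ≥ δ` then `‖ |T|^{1/2} (T − iη)⁻¹ ‖ ≤ 1/√(2|η|)`. -/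
theorem norm_absHalf_resolvent_bound
    {H : Type*} [NormedAddCommGroup H] [InnerProductSpace ℂ H] [CompleteSpace H]
    (δ : ℝ) (hδ : 0 < δ)
    (T : H →L[ℂ] H) (hT : IsSelfAdjoint T)
    (hspec : ∀ x ∈ spectrum ℝ T, x ∉ Set.Ioo (-δ) δ) (η : ℝ) :
    (|η| ≤ δ →
      ‖cfc (fun x : ℝ => Real.sqrt |x|) T ∘L
          Ring.inverse (T - ((η : ℂ) * Complex.I) • (1 : H →L[ℂ] H))‖
        ≤ Real.sqrt δ / Real.sqrt (δ ^ 2 + η ^ 2)) ∧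
    (δ ≤ |η| →
      ‖cfc (fun x : ℝ => Real.sqrt |x|) T ∘L
          Ring.inverse (T - ((η : ℂ) * Complex.I) • (1 : H →L[ℂ] H))‖
        ≤ 1 / Real.sqrt (2 * |η|)) := by
  have habs : ∀ x ∈ spectrum ℝ T, δ ≤ |x| := fun x hx => by
    by_contra! h
    exact hspec x hx (abs_lt.mp h)
  have hne : ∀ x ∈ spectrum ℝ T, x ≠ 0 := fun x hx =>
    abs_pos.mp (hδ.trans_le (habs x hx))
  refine ⟨fun hη => ?_, fun hη => ?_⟩
  · refine norm_absHalf_resolvent_le hT (by positivity) hne fun x hx => ?_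
    have hx := habs x hx
    rw [div_pow, Real.sq_sqrt hδ.le, Real.sq_sqrt (by positivity), div_mul_eq_mul_div,
      le_div_iff₀ (by positivity), ← sq_abs x, ← sq_abs η]
    have hηx : |η| ^ 2 ≤ δ * |x| := by
      nlinarith [abs_nonneg η]
    nlinarith [mul_nonneg (sub_nonneg.mpr hx) (sub_nonneg.mpr hηx)]
  · have hη_pos : 0 < |η| := hδ.trans_le hη
    refine norm_absHalf_resolvent_le hT (by positivity) hne fun x _ => ?_
    rw [div_pow, Real.sq_sqrt (by positivity), div_mul_eq_mul_div,
      le_div_iff₀ (by positivity), ← sq_abs x, ← sq_abs η]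
    nlinarith [sq_nonneg (|x| - |η|)]
end

section
/- Let H be a complex Hilbert space, δ > 0, and let D be a bounded self-adjoint operator on H whose spectrum is disjoint from (−δ, δ), so that sgn(D) is defined by the continuous functional calculus and Λ⁺ := (1/2)(1 + sgn(D)). Then for every bounded operator M on H one has ‖ sgn(D)∘M − M∘sgn(D) ‖ ≤ (1/δ) ‖ D∘M − M∘D ‖, and consequently ‖ Λ⁺∘M − M∘Λ⁺ ‖ ≤ ‖ D∘M − M∘D ‖ / (2δ). -/
open Filter Topology in
/-- If `‖1 - ε a‖ ≤ 1 - ε δ` for small `ε > 0`, then the map `x ↦ a x + x a` is bounded below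
by `2 δ`. -/
theorem two_mul_norm_le_norm_mul_add_mul {R : Type*} [NormedRing R] [NormedAlgebra ℝ R]
    {a : R} {δ : ℝ} (ha : ∀ᶠ ε : ℝ in 𝓝[>] 0, ‖1 - ε • a‖ ≤ 1 - ε * δ) (x : R) :
    2 * δ * ‖x‖ ≤ ‖a * x + x * a‖ := by
  have key : ∀ᶠ ε : ℝ in 𝓝[>] 0,
      (2 * δ - ε * (δ ^ 2 + ‖a‖ * ‖a‖)) * ‖x‖ ≤ ‖a * x + x * a‖ := by
    filter_upwards [ha, self_mem_nhdsWithin] with ε hε hpos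
    have hpos : 0 < ε := hpos
    have hx : x = ε • (a * x + x * a) + ((1 - ε • a) * x * (1 - ε • a)
        - (ε * ε) • (a * x * a)) := by
      simp only [sub_mul, mul_sub, one_mul, mul_one, smul_mul_assoc, mul_smul_comm, smul_add,
        smul_sub, mul_smul, mul_assoc]
      abel
    have h₁ : ‖(1 - ε • a) * x * (1 - ε • a)‖ ≤ (1 - ε * δ) * ‖x‖ * (1 - ε * δ) := by
      have h₀ := (norm_nonneg _).trans hε
      refine (norm_mul_le _ _).trans ?_
      gcongr
      refine (norm_mul_le _ _).trans ?_
      gcongr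
    have h₂ : ‖(ε * ε) • (a * x * a)‖ ≤ ε * ε * (‖a‖ * ‖x‖ * ‖a‖) := by
      rw [norm_smul, Real.norm_of_nonneg (by positivity)]
      gcongr
      exact norm_mul₃_le
    have h₃ : ‖ε • (a * x + x * a)‖ = ε * ‖a * x + x * a‖ := by
      rw [norm_smul, Real.norm_of_nonneg hpos.le]
    have h₄ : ‖x‖ ≤ ε * ‖a * x + x * a‖ + ((1 - ε * δ) * ‖x‖ * (1 - ε * δ)
        + ε * ε * (‖a‖ * ‖x‖ * ‖a‖)) := by
      calc ‖x‖ = ‖ε • (a * x + x * a) + ((1 - ε • a) * x * (1 - ε • a)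
            - (ε * ε) • (a * x * a))‖ := congrArg _ hx
        _ ≤ _ := (norm_add_le _ _).trans
          (add_le_add h₃.le ((norm_sub_le _ _).trans (add_le_add h₁ h₂)))
    refine le_of_mul_le_mul_left ?_ hpos
    linarith
  have hlim : Tendsto (fun ε : ℝ ↦ (2 * δ - ε * (δ ^ 2 + ‖a‖ * ‖a‖)) * ‖x‖) (𝓝[>] 0)
      (𝓝 (2 * δ * ‖x‖)) := by
    have hc : Continuous fun ε : ℝ ↦ (2 * δ - ε * (δ ^ 2 + ‖a‖ * ‖a‖)) * ‖x‖ := by fun_prop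
    simpa using (hc.tendsto 0).mono_left nhdsWithin_le_nhds
  exact le_of_tendsto hlim key

theorem Real.continuousOn_sign : ContinuousOn Real.sign {0}ᶜ := by
  intro x hx
  refine ContinuousAt.continuousWithinAt ?_
  rcases lt_or_gt_of_ne (Set.mem_compl_singleton_iff.mp hx) with h | h
  · exact (continuousAt_const (y := (-1 : ℝ))).congr
      ((eventually_lt_nhds h).mono fun y hy ↦ (Real.sign_of_neg hy).symm)
  · exact (continuousAt_const (y := (1 : ℝ))).congr
      ((eventually_gt_nhds h).mono fun y hy ↦ (Real.sign_of_pos hy).symm)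

open Filter Topology in
/-- In a C⋆-algebra, if the self-adjoint element `d` has a spectral gap `(-δ, δ)`, then
commutators with `sgn d` are bounded by `δ⁻¹` times commutators with `d`. -/
theorem mul_norm_commutator_cfc_sign_le {A : Type*} [CStarAlgebra A] {d : A}
    (hd : IsSelfAdjoint d) {δ : ℝ} (hδ : 0 < δ) (hspec : ∀ t ∈ spectrum ℝ d, δ ≤ |t|) (m : A) :
    δ * ‖cfc Real.sign d * m - m * cfc Real.sign d‖ ≤ ‖d * m - m * d‖ := by
  have hne : ∀ t ∈ spectrum ℝ d, t ≠ 0 := fun t ht ↦ abs_pos.mp (hδ.trans_le (hspec t ht))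
  have hcont : ContinuousOn Real.sign (spectrum ℝ d) := Real.continuousOn_sign.mono hne
  set s := cfc Real.sign d with hs
  have hss : s * s = 1 := by
    rw [hs, ← cfc_mul Real.sign Real.sign d, ← cfc_one ℝ d]
    refine cfc_congr fun t ht ↦ ?_
    rcases Real.sign_apply_eq_of_ne_zero t (hne t ht) with h | h <;> simp [h]
  have hsd : s * d = d * s := by
    simpa only [cfc_id ℝ d] using (cfc_commute_cfc Real.sign id d).eq
  have hs1 : ‖s‖ ≤ 1 := by
    refine norm_cfc_le zero_le_one fun t ht ↦ ?_
    rcases Real.sign_apply_eq_of_ne_zero t (hne t ht) with h | h <;> simp [h]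
  have habs : s * d = cfc (fun t : ℝ ↦ |t|) d := by
    have hmul := cfc_mul Real.sign id d
    rw [cfc_id ℝ d] at hmul
    rw [← hmul]
    refine cfc_congr fun t ht ↦ ?_
    rcases lt_or_gt_of_ne (hne t ht) with h | h
    · simp [Real.sign_of_neg h, abs_of_neg h]
    · simp [Real.sign_of_pos h, abs_of_pos h]
  have hgap : ∀ᶠ ε : ℝ in 𝓝[>] 0, ‖1 - ε • (s * d)‖ ≤ 1 - ε * δ := by
    have small (c : ℝ) : ∀ᶠ ε : ℝ in 𝓝[>] 0, ε * c < 1 := by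
      have hc : Continuous fun ε : ℝ ↦ ε * c := by fun_prop
      exact nhdsWithin_le_nhds (hc.continuousAt.eventually_lt_const (by simp))
    filter_upwards [small δ, small (‖d‖ * ‖(1 : A)‖), self_mem_nhdsWithin] with ε h₁ h₂ hpos
    have hpos : 0 < ε := hpos
    rw [habs, ← cfc_smul ε (fun t : ℝ ↦ |t|) d, ← cfc_one ℝ d, ← cfc_sub _ _ d]
    refine norm_cfc_le (sub_nonneg.mpr h₁.le) fun t ht ↦ ?_
    have h₃ : |t| ≤ ‖d‖ * ‖(1 : A)‖ := spectrum.norm_le_norm_mul_of_mem ht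
    have h₄ := mul_le_mul_of_nonneg_left h₃ hpos.le
    have h₅ := mul_le_mul_of_nonneg_left (hspec t ht) hpos.le
    simp only [Pi.one_apply, smul_eq_mul, Real.norm_eq_abs]
    rw [abs_of_nonneg (by linarith)]
    linarith
  have hcomm : s * d * (s * m - m * s) + (s * m - m * s) * (s * d)
      = (d * m - m * d) - s * (d * m - m * d) * s := by
    have e₁ : s * d * (s * m) = d * m := by
      rw [hsd, mul_assoc, ← mul_assoc s s m, hss, one_mul]
    have e₂ : m * s * (s * d) = m * d := by
      rw [mul_assoc, ← mul_assoc s s d, hss, one_mul]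
    have e₃ : s * m * (s * d) = s * (m * d) * s := by
      rw [hsd]; simp only [mul_assoc]
    have e₄ : s * d * (m * s) = s * (d * m) * s := by simp only [mul_assoc]
    rw [mul_sub, sub_mul, e₁, e₂, e₃, e₄, mul_sub, sub_mul]
    abel
  have hle := two_mul_norm_le_norm_mul_add_mul hgap (s * m - m * s)
  rw [hcomm] at hle
  have hconj : ‖s * (d * m - m * d) * s‖ ≤ ‖d * m - m * d‖ :=
    calc ‖s * (d * m - m * d) * s‖ ≤ ‖s‖ * ‖d * m - m * d‖ * ‖s‖ := norm_mul₃_le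
      _ ≤ 1 * ‖d * m - m * d‖ * 1 := by gcongr
      _ = ‖d * m - m * d‖ := by ring
  linarith [norm_sub_le (d * m - m * d) (s * (d * m - m * d) * s)]

/-- For a bounded self-adjoint operator `D` with spectrum disjoint from
`(−δ, δ)`, `δ > 0`, with `Λ⁺ := (1/2)(1 + sgn D)`, each bounded operator `M` satisfies
`‖sgn(D)M − M sgn(D)‖ ≤ ‖DM − MD‖/δ` and `‖Λ⁺M − MΛ⁺‖ ≤ ‖DM − MD‖/(2δ)`. -/
theorem sgn_commutator_bound
    {H : Type*} [NormedAddCommGroup H] [InnerProductSpace ℂ H] [CompleteSpace H]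
    (δ : ℝ) (hδ : 0 < δ)
    (D : H →L[ℂ] H) (hD : IsSelfAdjoint D)
    (hspec : ∀ x ∈ spectrum ℝ D, x ∉ Set.Ioo (-δ) δ)
    (M : H →L[ℂ] H) :
    ‖cfc Real.sign D ∘L M - M ∘L cfc Real.sign D‖ ≤ (1 / δ) * ‖D ∘L M - M ∘L D‖ ∧
    ‖((1 / 2 : ℂ) • (1 + cfc Real.sign D)) ∘L M
        - M ∘L ((1 / 2 : ℂ) • (1 + cfc Real.sign D))‖
      ≤ ‖D ∘L M - M ∘L D‖ / (2 * δ) := by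
  have hgap : ∀ t ∈ spectrum ℝ D, δ ≤ |t| := fun t ht ↦
    not_lt.mp fun h ↦ hspec t ht (abs_lt.mp h)
  have hsgn := mul_norm_commutator_cfc_sign_le hD hδ hgap M
  simp only [← ContinuousLinearMap.mul_def]
  have hproj : ((1 / 2 : ℂ) • (1 + cfc Real.sign D)) * M
      - M * ((1 / 2 : ℂ) • (1 + cfc Real.sign D))
      = (1 / 2 : ℂ) • (cfc Real.sign D * M - M * cfc Real.sign D) := by
    rw [smul_mul_assoc, mul_smul_comm, ← smul_sub, add_mul, mul_add, one_mul, mul_one,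
      add_sub_add_left_eq_sub]
  constructor
  · rw [one_div, ← div_eq_inv_mul, le_div_iff₀' hδ]
    exact hsgn
  · rw [hproj, norm_smul, le_div_iff₀' (by positivity)]
    norm_num
    linarith
end

section
/- Let H be a complex Hilbert space and let D be a bounded self-adjoint invertible operator on H; set sgn(D) := cfc of the sign function and Λ⁺ := (1/2)(1 + sgn(D)). Then for every bounded operator M on H one has ‖ |D|^{1/2} ∘ (Λ⁺∘M − M∘Λ⁺) ∘ |D|^{1/2} ‖ ≤ (1/2) ‖ D∘M − M∘D ‖, where |D|^{1/2} is the continuous functional calculus of D applied to x ↦ √|x|. -/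
open ContinuousLinearMap in
/-- The gap `‖K‖² ‖u‖² - ‖K u‖²` controls how far `u` is from an eigenvector of `K† K`. -/
lemma norm_adjoint_comp_apply_sub_sq_le
    {H : Type*} [NormedAddCommGroup H] [InnerProductSpace ℂ H] [CompleteSpace H]
    (K : H →L[ℂ] H) (u : H) :
    ‖adjoint K (K u) - ((‖K‖ ^ 2 : ℝ) : ℂ) • u‖ ^ 2
      ≤ ‖K‖ ^ 2 * (‖K‖ ^ 2 * ‖u‖ ^ 2 - ‖K u‖ ^ 2) := by
  have h1 : ‖adjoint K (K u)‖ ≤ ‖K‖ * ‖K u‖ := by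
    simpa using (adjoint K).le_opNorm (K u)
  have h2 : RCLike.re (inner ℂ (adjoint K (K u)) (((‖K‖ ^ 2 : ℝ) : ℂ) • u))
      = ‖K‖ ^ 2 * ‖K u‖ ^ 2 := by
    rw [adjoint_inner_left, map_smul, inner_smul_right, RCLike.re_to_complex,
      Complex.re_ofReal_mul, ← RCLike.re_to_complex, inner_self_eq_norm_sq]
  have h3 : ‖((‖K‖ ^ 2 : ℝ) : ℂ) • u‖ = ‖K‖ ^ 2 * ‖u‖ := by
    rw [norm_smul, Complex.norm_real, Real.norm_of_nonneg (by positivity)]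
  rw [@norm_sub_sq ℂ, h2, h3]
  have h4 : ‖adjoint K (K u)‖ ^ 2 ≤ (‖K‖ * ‖K u‖) ^ 2 := by gcongr
  nlinarith

open ContinuousLinearMap in
/-- The operator arithmetic-geometric mean inequality. -/
lemma norm_mul_mul_le_half_norm_sq_mul_add_mul_sq
    {H : Type*} [NormedAddCommGroup H] [InnerProductSpace ℂ H] [CompleteSpace H]
    (B X : H →L[ℂ] H) (hB : IsSelfAdjoint B) (hBu : IsUnit B) :
    ‖B * X * B‖ ≤ (1 / 2) * ‖B * B * X + X * (B * B)‖ := by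
  obtain ⟨⟨B, C, hBC, hCB⟩, rfl⟩ := hBu
  simp only at hB ⊢
  have hBC' (x : H) : B (C x) = x := congr($hBC x)
  have hCB' (x : H) : C (B x) = x := congr($hCB x)
  have hBsymm (x y : H) : inner ℂ (B x) y = inner ℂ x (B y) := hB.isSymmetric x y
  set Y := B * B * X + X * (B * B) with hY
  set K := B * X * B with hK
  set k := ‖K‖ with hk
  by_contra! hlt
  set c := (1 / 2) * ‖Y‖ with hc
  have hc0 : 0 ≤ c := by positivity
  have hk0 : 0 < k := hc0.trans_lt hlt
  have key (u : H) : (k - c) * k * ‖u‖ ≤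
      ‖B‖ * ‖C‖ * ‖adjoint K (K u) - ((k ^ 2 : ℝ) : ℂ) • u‖ := by
    set r := adjoint K (K u) - ((k ^ 2 : ℝ) : ℂ) • u with hr
    set p := C (K u) with hp
    set q := (k : ℂ) • C u with hq
    have hu : k * ‖u‖ ≤ ‖B‖ * ‖q‖ := by
      have : B q = (k : ℂ) • u := by simp [hq, hBC']
      simpa [this, norm_smul, abs_of_pos hk0] using B.le_opNorm q
    have e1 : inner ℂ p (X (B (B q))) = ((k * ‖p‖ ^ 2 : ℝ) : ℂ) := by
      have : X (B (B q)) = (k : ℂ) • p := by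
        simp [hq, hp, hK, hBC', hCB']
      rw [this, inner_smul_right, inner_self_eq_norm_sq_to_K]
      simp
    have e2 : inner ℂ p (B (B (X q))) = ((k * ‖q‖ ^ 2 : ℝ) : ℂ) + inner ℂ (C r) q := by
      have h : inner ℂ p (B (B (X q))) = inner ℂ (C (adjoint K (K u))) q := by
        have hadj : adjoint K (K u) = B (adjoint X (B (K u))) := by
          apply ext_inner_right ℂ
          intro v
          rw [adjoint_inner_left, hBsymm, adjoint_inner_left, hBsymm]
          rfl
        rw [hadj, hCB', adjoint_inner_left, ← hBsymm, hp, hBC', hBsymm]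
      have h' : C (adjoint K (K u)) = (k : ℂ) • q + C r := by
        rw [hr, hq, map_sub, map_smul, smul_smul, ← Complex.ofReal_mul, ← sq, add_sub_cancel]
      rw [h, h', inner_add_left, inner_smul_left, inner_self_eq_norm_sq_to_K]
      simp
    have e3 : inner ℂ p (Y q) = ((k * (‖p‖ ^ 2 + ‖q‖ ^ 2) : ℝ) : ℂ) + inner ℂ (C r) q := by
      have : Y q = B (B (X q)) + X (B (B q)) := rfl
      rw [this, inner_add_right, e1, e2]
      push_cast
      ring
    have e4 : k * (‖p‖ ^ 2 + ‖q‖ ^ 2) ≤ ‖p‖ * (‖Y‖ * ‖q‖) + ‖C‖ * ‖r‖ * ‖q‖ := by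
      have h1 : ((k * (‖p‖ ^ 2 + ‖q‖ ^ 2) : ℝ) : ℂ) = inner ℂ p (Y q) - inner ℂ (C r) q := by
        rw [e3]; ring
      calc k * (‖p‖ ^ 2 + ‖q‖ ^ 2) = ‖((k * (‖p‖ ^ 2 + ‖q‖ ^ 2) : ℝ) : ℂ)‖ := by
            rw [Complex.norm_real, Real.norm_of_nonneg (by positivity)]
        _ ≤ ‖inner ℂ p (Y q)‖ + ‖inner ℂ (C r) q‖ := by rw [h1]; exact norm_sub_le _ _
        _ ≤ ‖p‖ * ‖Y q‖ + ‖C r‖ * ‖q‖ := add_le_add (norm_inner_le_norm _ _) (norm_inner_le_norm _ _)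
        _ ≤ _ := by gcongr <;> exact le_opNorm _ _
    have e5 : (k - c) * ‖q‖ ^ 2 ≤ ‖C‖ * ‖r‖ * ‖q‖ := by
      have hYc : ‖Y‖ = 2 * c := by rw [hc]; ring
      rw [hYc] at e4
      nlinarith [mul_nonneg hc0 (sq_nonneg (‖p‖ - ‖q‖)),
        mul_nonneg (sub_nonneg.2 hlt.le) (sq_nonneg ‖p‖)]
    have e6 : (k - c) * ‖q‖ ≤ ‖C‖ * ‖r‖ := by
      rcases (norm_nonneg q).eq_or_lt with h | h
      · rw [← h]; simp; positivity
      · exact le_of_mul_le_mul_right (by linarith) h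
    calc (k - c) * k * ‖u‖ = (k - c) * (k * ‖u‖) := by ring
      _ ≤ (k - c) * (‖B‖ * ‖q‖) := mul_le_mul_of_nonneg_left hu (sub_nonneg.2 hlt.le)
      _ = ‖B‖ * ((k - c) * ‖q‖) := by ring
      _ ≤ ‖B‖ * (‖C‖ * ‖r‖) := by gcongr
      _ = _ := by ring
  set L := ‖B‖ * ‖C‖ + 1 with hL
  have hL0 : 0 < L := by positivity
  have gap (u : H) : (k - c) ^ 2 * ‖u‖ ^ 2 ≤ L ^ 2 * (k ^ 2 * ‖u‖ ^ 2 - ‖K u‖ ^ 2) := by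
    have h1 := norm_adjoint_comp_apply_sub_sq_le K u
    rw [← hk] at h1
    have h2 : (k - c) * k * ‖u‖ ≤ L * ‖adjoint K (K u) - ((k ^ 2 : ℝ) : ℂ) • u‖ :=
      (key u).trans (by gcongr; simp [hL])
    have h3 : 0 ≤ (k - c) * k * ‖u‖ := by have := sub_pos.2 hlt; positivity
    have h4 := pow_le_pow_left₀ h3 h2 2
    have h5 : k ^ 2 * ((k - c) ^ 2 * ‖u‖ ^ 2)
        ≤ k ^ 2 * (L ^ 2 * (k ^ 2 * ‖u‖ ^ 2 - ‖K u‖ ^ 2)) := by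
      nlinarith [mul_le_mul_of_nonneg_left h1 (sq_nonneg L)]
    exact le_of_mul_le_mul_left h5 (by positivity)
  have hδ : 0 < ((k - c) / L) ^ 2 := by have := sub_pos.2 hlt; positivity
  have bound : k ≤ √(k ^ 2 - ((k - c) / L) ^ 2) := by
    refine K.opNorm_le_bound (Real.sqrt_nonneg _) fun u => ?_
    have h1 : ‖K u‖ ^ 2 ≤ (k ^ 2 - ((k - c) / L) ^ 2) * ‖u‖ ^ 2 := by
      have h := gap u
      rw [← div_le_iff₀' (by positivity)] at h
      rw [div_pow]
      have : (k - c) ^ 2 / L ^ 2 * ‖u‖ ^ 2 = (k - c) ^ 2 * ‖u‖ ^ 2 / L ^ 2 := by ring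
      linarith
    calc ‖K u‖ ≤ √((k ^ 2 - ((k - c) / L) ^ 2) * ‖u‖ ^ 2) := Real.le_sqrt_of_sq_le h1
      _ = _ := by rw [Real.sqrt_mul' _ (by positivity), Real.sqrt_sq (norm_nonneg u)]
  have h := (Real.le_sqrt' hk0).1 bound
  linarith

/-- For a bounded self-adjoint invertible operator `D`,
put `Λ⁺ := (1/2)(1 + sgn D)`. Then for every bounded operator `M`:
`‖ |D|^{1/2} (Λ⁺M − MΛ⁺) |D|^{1/2} ‖ ≤ (1/2) ‖DM − MD‖`. -/
theorem weighted_projection_commutator_bound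
    {H : Type*} [NormedAddCommGroup H] [InnerProductSpace ℂ H] [CompleteSpace H]
    (D : H →L[ℂ] H) (hD : IsSelfAdjoint D) (hDinv : IsUnit D)
    (M : H →L[ℂ] H) :
    ‖cfc (fun x : ℝ => Real.sqrt |x|) D ∘L
        (((1 / 2 : ℂ) • (1 + cfc Real.sign D)) ∘L M
          - M ∘L ((1 / 2 : ℂ) • (1 + cfc Real.sign D))) ∘L
        cfc (fun x : ℝ => Real.sqrt |x|) D‖
      ≤ (1 / 2) * ‖D ∘L M - M ∘L D‖ := by
  have h0 : ∀ x ∈ spectrum ℝ D, x ≠ 0 := fun x hx => by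
    rintro rfl
    exact (spectrum.zero_mem_iff ℝ).1 hx hDinv
  have hsc : ContinuousOn Real.sign (spectrum ℝ D) := by
    intro x hx
    refine ContinuousAt.continuousWithinAt ?_
    rcases (h0 x hx).lt_or_gt with h | h
    · refine continuousAt_const.congr (f := fun _ => -1) ?_
      filter_upwards [gt_mem_nhds h] with y hy using (Real.sign_of_neg hy).symm
    · refine continuousAt_const.congr (f := fun _ => 1) ?_
      filter_upwards [lt_mem_nhds h] with y hy using (Real.sign_of_pos hy).symm
  have hBc : ContinuousOn (fun x : ℝ => √|x|) (spectrum ℝ D) := by fun_prop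
  have hBu : IsUnit (cfc (fun x : ℝ => √|x|) D) := by
    rw [isUnit_cfc_iff _ _ hBc]
    intro x hx
    have := abs_pos.2 (h0 x hx)
    positivity
  have hBsa : IsSelfAdjoint (cfc (fun x : ℝ => √|x|) D) := cfc_predicate _ _
  have hSnorm : ‖cfc Real.sign D‖ ≤ 1 := by
    refine norm_cfc_le zero_le_one fun x _ => ?_
    rcases Real.sign_apply_eq x with h | h | h <;> simp [h]
  have hSS : cfc Real.sign D * cfc Real.sign D = 1 := by
    rw [← cfc_mul _ _ D hsc hsc, ← cfc_one ℝ D]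
    refine cfc_congr fun x hx => ?_
    rcases (h0 x hx).lt_or_gt with h | h
    · simp [Real.sign_of_neg h]
    · simp [Real.sign_of_pos h]
  have hBB : cfc (fun x : ℝ => √|x|) D * cfc (fun x : ℝ => √|x|) D = cfc Real.sign D * D := by
    have h : cfc Real.sign D * D = cfc (fun x : ℝ => Real.sign x * x) D := by
      rw [cfc_mul _ _ D hsc (by fun_prop), cfc_id' ℝ D]
    rw [h, ← cfc_mul _ _ D hBc hBc]
    refine cfc_congr fun x hx => ?_
    rw [Real.mul_self_sqrt (abs_nonneg x)]
    rcases (h0 x hx).lt_or_gt with h | h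
    · simp [Real.sign_of_neg h, abs_of_neg h]
    · simp [Real.sign_of_pos h, abs_of_pos h]
  have hSD : cfc Real.sign D * D = D * cfc Real.sign D :=
    ((Commute.refl D).cfc_real Real.sign).eq
  simp only [← ContinuousLinearMap.mul_def]
  generalize cfc (fun x : ℝ => √|x|) D = B at *
  generalize cfc Real.sign D = S at *
  set X := ((1 / 2 : ℂ) • (1 + S)) * M - M * ((1 / 2 : ℂ) • (1 + S)) with hX
  set N := D * M - M * D with hN
  have hXN : B * B * X + X * (B * B) = (1 / 2 : ℂ) • (N - S * N * S) := by
    have hX' : X = (1 / 2 : ℂ) • (S * M - M * S) := by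
      rw [hX, smul_mul_assoc, mul_smul_comm, ← smul_sub]
      noncomm_ring
    have h1 : S * D * (S * M - M * S) = D * M - S * D * M * S := by
      rw [mul_sub, hSD, mul_assoc D S, ← mul_assoc S S, hSS, one_mul, ← hSD]
      noncomm_ring
    have h2 : (S * M - M * S) * (S * D) = S * M * D * S - M * D := by
      rw [sub_mul, mul_assoc M S, ← mul_assoc S S, hSS, one_mul, hSD]
      noncomm_ring
    rw [hBB, hX', mul_smul_comm, smul_mul_assoc, ← smul_add, h1, h2, hN]
    congr 1
    noncomm_ring
  have hbound : ‖(1 / 2 : ℂ) • (N - S * N * S)‖ ≤ ‖N‖ := by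
    have h1 : ‖S * N * S‖ ≤ ‖N‖ := by
      calc ‖S * N * S‖ ≤ ‖S‖ * ‖N‖ * ‖S‖ :=
            (norm_mul_le _ _).trans (by gcongr; exact norm_mul_le _ _)
        _ ≤ 1 * ‖N‖ * 1 := by gcongr
        _ = ‖N‖ := by ring
    rw [norm_smul]
    have h2 := norm_sub_le N (S * N * S)
    norm_num
    linarith
  rw [← mul_assoc]
  calc ‖B * X * B‖ ≤ (1 / 2) * ‖B * B * X + X * (B * B)‖ :=
        norm_mul_mul_le_half_norm_sq_mul_add_mul_sq B X hBsa hBu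
    _ ≤ (1 / 2) * ‖N‖ := by rw [hXN]; gcongr
end

section
/- Let H be a complex Hilbert space, δ > 0, and let D be a bounded self-adjoint operator on H whose spectrum is disjoint from (−δ, δ); set Λ⁺ := (1/2)(1 + sgn(D)). Let W be a bounded invertible operator on H and put K := W∘D∘W⁻¹ − D. If ‖K‖ < δ, then ‖ W∘Λ⁺∘W⁻¹ − Λ⁺ ‖ ≤ ‖K‖ / (2(δ − ‖K‖)). -/
open MeasureTheory in
theorem integral_univ_div_sq_add_sq {x : ℝ} (hx : x ≠ 0) :
    ∫ y : ℝ, x / (x ^ 2 + y ^ 2) = Real.pi * Real.sign x := by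
  have h (y : ℝ) : x / (x ^ 2 + y ^ 2) = x⁻¹ * (1 + (y / x) ^ 2)⁻¹ := by
    have : x ^ 2 + y ^ 2 ≠ 0 := by positivity
    field_simp
  simp_rw [h]
  rw [integral_const_mul, Measure.integral_comp_div (fun y : ℝ ↦ (1 + y ^ 2)⁻¹) x,
    integral_univ_inv_one_add_sq, smul_eq_mul]
  rcases hx.lt_or_gt with hx' | hx'
  · rw [abs_of_neg hx', Real.sign_of_neg hx']
    field_simp
  · rw [abs_of_pos hx', Real.sign_of_pos hx']
    field_simp

open MeasureTheory in
theorem integrable_inv_sq_add_sq {x : ℝ} (hx : x ≠ 0) :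
    Integrable fun y : ℝ ↦ (x ^ 2 + y ^ 2)⁻¹ := by
  refine ((integrable_inv_one_add_sq.comp_div hx).const_mul (x ^ 2)⁻¹).congr
    (.of_forall fun y ↦ ?_)
  have : x ^ 2 + y ^ 2 ≠ 0 := by positivity
  field_simp

theorem norm_conj_sub_le_of_mul_eq_one {A : Type*} [NormedRing A] (u : Aˣ) {a r : A}
    (har : a * r = 1) (hra : r * a = 1) {s : ℝ} (hs : ‖r‖ ≤ s⁻¹)
    (hk : ‖u * a * ↑u⁻¹ - a‖ < s) :
    ‖u * r * ↑u⁻¹ - r‖ ≤ ‖u * a * ↑u⁻¹ - a‖ / (s * (s - ‖u * a * ↑u⁻¹ - a‖)) := by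
  set k : A := u * a * ↑u⁻¹ - a with hk_def
  set r' : A := u * r * ↑u⁻¹ with hr'
  have hs0 : 0 < s := (norm_nonneg _).trans_lt hk
  have h1 : r' * (u * a * ↑u⁻¹) = 1 := by
    calc r' * (u * a * ↑u⁻¹) = u * (r * (↑u⁻¹ * u) * a) * ↑u⁻¹ := by
          simp only [hr', mul_assoc]
      _ = 1 := by simp [hra]
  have hsub : r' - r = -(r' * k * r) := by
    rw [hk_def, mul_sub, h1, sub_mul, one_mul, mul_assoc, har, mul_one, neg_sub]
  have hdiff : ‖r' - r‖ ≤ ‖r'‖ * ‖k‖ * s⁻¹ := by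
    rw [hsub, norm_neg]
    exact (norm_mul₃_le ..).trans (by gcongr)
  have hr'_le : ‖r'‖ ≤ s⁻¹ + ‖r'‖ * ‖k‖ * s⁻¹ := by
    calc ‖r'‖ = ‖r + (r' - r)‖ := by rw [add_sub_cancel]
      _ ≤ _ := (norm_add_le _ _).trans (add_le_add hs hdiff)
  have hr'_bound : ‖r'‖ ≤ (s - ‖k‖)⁻¹ := by
    rw [← one_div, le_div_iff₀ (sub_pos.2 hk)]
    have := mul_le_mul_of_nonneg_right hr'_le hs0.le
    field_simp at this
    linarith
  calc ‖r' - r‖ ≤ ‖r'‖ * ‖k‖ * s⁻¹ := hdiff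
    _ ≤ (s - ‖k‖)⁻¹ * ‖k‖ * s⁻¹ := by gcongr
    _ = _ := by
      have := (sub_pos.2 hk).ne'
      field_simp

section CStarAlgebra

variable {A : Type*} [CStarAlgebra A] {a : A} {δ : ℝ}

theorem IsSelfAdjoint.re_mem_spectrum_real (ha : IsSelfAdjoint a) {z : ℂ}
    (hz : z ∈ spectrum ℂ a) : z.re ∈ spectrum ℝ a := by
  rw [ha.mem_spectrum_eq_re hz] at hz
  exact spectrum.of_algebraMap_mem ℂ hz

/-- The resolvent of a self-adjoint element at the imaginary number `i y`. -/
noncomputable def imagResolvent (a : A) (y : ℝ) : A :=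
  cfc (fun z : ℂ ↦ (z - y * Complex.I)⁻¹) a

theorem sub_mul_I_ne_zero (hδ : 0 < δ) (ha : IsSelfAdjoint a)
    (hspec : ∀ x ∈ spectrum ℝ a, δ ≤ |x|) (y : ℝ) {z : ℂ} (hz : z ∈ spectrum ℂ a) :
    z - y * Complex.I ≠ 0 := by
  intro h
  have hre : z.re = 0 := by simpa using congrArg Complex.re h
  have := hspec _ (ha.re_mem_spectrum_real hz)
  rw [hre, abs_zero] at this
  linarith

theorem continuousOn_inv_sub_mul_I (hδ : 0 < δ) (ha : IsSelfAdjoint a)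
    (hspec : ∀ x ∈ spectrum ℝ a, δ ≤ |x|) (y : ℝ) :
    ContinuousOn (fun z : ℂ ↦ (z - y * Complex.I)⁻¹) (spectrum ℂ a) :=
  ContinuousOn.inv₀ (by fun_prop) fun _ hz ↦ sub_mul_I_ne_zero hδ ha hspec y hz

theorem cfc_sub_mul_I (ha : IsSelfAdjoint a) (y : ℝ) :
    cfc (fun z : ℂ ↦ z - y * Complex.I) a = a - algebraMap ℂ A (y * Complex.I) := by
  have : IsStarNormal a := ha.isStarNormal
  rw [cfc_sub .., cfc_id' ℂ a, cfc_const ..]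

theorem mul_imagResolvent (hδ : 0 < δ) (ha : IsSelfAdjoint a)
    (hspec : ∀ x ∈ spectrum ℝ a, δ ≤ |x|) (y : ℝ) :
    (a - algebraMap ℂ A (y * Complex.I)) * imagResolvent a y = 1 := by
  have : IsStarNormal a := ha.isStarNormal
  have hc := continuousOn_inv_sub_mul_I hδ ha hspec y
  rw [← cfc_sub_mul_I ha, imagResolvent, ← cfc_mul .., ← cfc_one ℂ a]
  exact cfc_congr fun z hz ↦ mul_inv_cancel₀ (sub_mul_I_ne_zero hδ ha hspec y hz)

theorem imagResolvent_mul (hδ : 0 < δ) (ha : IsSelfAdjoint a)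
    (hspec : ∀ x ∈ spectrum ℝ a, δ ≤ |x|) (y : ℝ) :
    imagResolvent a y * (a - algebraMap ℂ A (y * Complex.I)) = 1 := by
  rw [← mul_imagResolvent hδ ha hspec y, ← cfc_sub_mul_I ha, imagResolvent]
  exact cfc_commute_cfc ..

theorem norm_imagResolvent_le (hδ : 0 < δ) (ha : IsSelfAdjoint a)
    (hspec : ∀ x ∈ spectrum ℝ a, δ ≤ |x|) (y : ℝ) :
    ‖imagResolvent a y‖ ≤ (√(δ ^ 2 + y ^ 2))⁻¹ := by
  refine norm_cfc_le (by positivity) fun z hz ↦ ?_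
  rw [norm_inv]
  gcongr
  have h := hspec _ (ha.re_mem_spectrum_real hz)
  have him := ha.im_eq_zero_of_mem_spectrum hz
  rw [Complex.norm_eq_sqrt_sq_add_sq]
  simp only [Complex.sub_re, Complex.mul_re, Complex.sub_im, Complex.mul_im, Complex.ofReal_re,
    Complex.ofReal_im, Complex.I_re, Complex.I_im, him, mul_zero, mul_one, sub_zero,
    add_zero, zero_sub, neg_sq]
  gcongr √(?_ + _)
  rw [← sq_abs z.re]
  gcongr

theorem cfc_div_sq_add_sq (hδ : 0 < δ) (ha : IsSelfAdjoint a)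
    (hspec : ∀ x ∈ spectrum ℝ a, δ ≤ |x|) (y : ℝ) :
    cfc (fun x : ℝ ↦ x / (x ^ 2 + y ^ 2)) a =
      (1 / 2 : ℂ) • (imagResolvent a y + imagResolvent a (-y)) := by
  have : IsStarNormal a := ha.isStarNormal
  have hc := continuousOn_inv_sub_mul_I hδ ha hspec
  rw [cfc_real_eq_complex .., imagResolvent, imagResolvent,
    ← cfc_add a _ _ (hc y) (hc (-y)),
    ← cfc_smul (1 / 2 : ℂ) (fun z : ℂ ↦ _ + _) a ((hc y).add (hc (-y)))]
  refine cfc_congr fun z hz ↦ ?_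
  have h1 := sub_mul_I_ne_zero hδ ha hspec y hz
  have h2 := sub_mul_I_ne_zero hδ ha hspec (-y) hz
  have hz' := ha.mem_spectrum_eq_re hz
  have hprod : z ^ 2 + y ^ 2 = (z - y * Complex.I) * (z - (-y : ℝ) * Complex.I) := by
    push_cast
    linear_combination (y ^ 2 : ℂ) * Complex.I_sq
  have h3 : z ^ 2 + (y : ℂ) ^ 2 ≠ 0 := hprod ▸ mul_ne_zero h1 h2
  simp only [smul_eq_mul]
  push_cast [neg_mul, sub_neg_eq_add] at h2 hprod ⊢
  rw [← hz', hprod]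
  field_simp
  ring

open MeasureTheory in
theorem integrable_cfc_div_sq_add_sq_and_integral (hδ : 0 < δ) (ha : IsSelfAdjoint a)
    (hspec : ∀ x ∈ spectrum ℝ a, δ ≤ |x|) :
    Integrable (fun y : ℝ ↦ cfc (fun x : ℝ ↦ x / (x ^ 2 + y ^ 2)) a) ∧
      ∫ y : ℝ, cfc (fun x : ℝ ↦ x / (x ^ 2 + y ^ 2)) a = Real.pi • cfc Real.sign a := by
  have hne {x : ℝ} (hx : x ∈ spectrum ℝ a) : x ≠ 0 :=
    abs_pos.1 (hδ.trans_le (hspec x hx))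
  have hcont : ContinuousOn (Function.uncurry fun y x : ℝ ↦ x / (x ^ 2 + y ^ 2))
      (Set.univ ×ˢ spectrum ℝ a) := by
    refine ContinuousOn.div (by fun_prop) (by fun_prop) fun p hp ↦ ?_
    have := hne hp.2
    positivity
  obtain ⟨M, hM⟩ := (spectrum.isCompact (𝕜 := ℝ) a).isBounded.exists_norm_le
  have hbound : ∀ᵐ y : ℝ, ∀ x ∈ spectrum ℝ a,
      ‖x / (x ^ 2 + y ^ 2)‖ ≤ M * (δ ^ 2 + y ^ 2)⁻¹ := by
    refine .of_forall fun y x hx ↦ ?_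
    have hM0 : 0 ≤ M := (norm_nonneg x).trans (hM x hx)
    rw [norm_div, div_eq_mul_inv, Real.norm_of_nonneg (by positivity : 0 ≤ x ^ 2 + y ^ 2)]
    have := hspec x hx
    gcongr ?_ * (?_ + _)⁻¹
    · exact hM x hx
    · rw [← sq_abs x]
      gcongr
  have hint := ((integrable_inv_sq_add_sq hδ.ne').const_mul M).hasFiniteIntegral
  refine ⟨integrable_cfc _ _ a hcont hbound hint ha, ?_⟩
  rw [← cfc_integral _ _ a hcont hbound hint ha]
  have hsign : ContinuousOn Real.sign (spectrum ℝ a) := by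
    refine ContinuousOn.congr (f := fun x ↦ x / |x|)
      (ContinuousOn.div (by fun_prop) (by fun_prop) fun x hx ↦ abs_ne_zero.2 (hne hx))
      fun x hx ↦ ?_
    dsimp only
    rcases (hne hx).lt_or_gt with h | h
    · rw [Real.sign_of_neg h, abs_of_neg h, div_neg, div_self h.ne]
    · rw [Real.sign_of_pos h, abs_of_pos h, div_self h.ne']
  rw [← cfc_smul _ _ a hsign]
  exact cfc_congr fun x hx ↦ integral_univ_div_sq_add_sq (hne hx)

theorem norm_conj_imagResolvent_sub_le (hδ : 0 < δ) (ha : IsSelfAdjoint a)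
    (hspec : ∀ x ∈ spectrum ℝ a, δ ≤ |x|) (u : Aˣ) (hu : ‖u * a * ↑u⁻¹ - a‖ < δ) (y : ℝ) :
    ‖u * imagResolvent a y * ↑u⁻¹ - imagResolvent a y‖ ≤
      ‖u * a * ↑u⁻¹ - a‖ * δ / (δ - ‖u * a * ↑u⁻¹ - a‖) * (δ ^ 2 + y ^ 2)⁻¹ := by
  set c := algebraMap ℂ A (y * Complex.I)
  set s := √(δ ^ 2 + y ^ 2) with hs
  have hconj : u * (a - c) * ↑u⁻¹ - (a - c) = u * a * ↑u⁻¹ - a := by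
    have : u * c * ↑u⁻¹ = c := by
      rw [← Algebra.commutes, mul_assoc, Units.mul_inv, mul_one]
    rw [mul_sub, sub_mul, this]
    abel
  have hδs : δ ≤ s := Real.le_sqrt_of_sq_le (by nlinarith)
  have h := norm_conj_sub_le_of_mul_eq_one u (mul_imagResolvent hδ ha hspec y)
    (imagResolvent_mul hδ ha hspec y) (norm_imagResolvent_le hδ ha hspec y)
    (by rw [hconj]; exact hu.trans_le hδs)
  rw [hconj] at h
  have hsq : δ ^ 2 + y ^ 2 = s ^ 2 := (Real.sq_sqrt (by positivity)).symm
  refine h.trans ?_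
  rw [← hs, hsq]
  clear_value s
  set k := ‖u * a * ↑u⁻¹ - a‖
  have hk : 0 ≤ k := norm_nonneg _
  have h1 : 0 < δ - k := sub_pos.2 hu
  have h2 : 0 < s - k := by linarith
  have h3 : 0 < s := by linarith
  rw [← div_eq_mul_inv, div_div, div_le_div_iff₀ (by positivity) (by positivity)]
  have : 0 ≤ k * s * (k * (s - δ)) :=
    mul_nonneg (by positivity) (mul_nonneg hk (by linarith))
  nlinarith

theorem norm_conj_cfc_div_sq_add_sq_sub_le (hδ : 0 < δ) (ha : IsSelfAdjoint a)
    (hspec : ∀ x ∈ spectrum ℝ a, δ ≤ |x|) (u : Aˣ) (hu : ‖u * a * ↑u⁻¹ - a‖ < δ) (y : ℝ) :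
    ‖u * cfc (fun x : ℝ ↦ x / (x ^ 2 + y ^ 2)) a * ↑u⁻¹ -
        cfc (fun x : ℝ ↦ x / (x ^ 2 + y ^ 2)) a‖ ≤
      ‖u * a * ↑u⁻¹ - a‖ * δ / (δ - ‖u * a * ↑u⁻¹ - a‖) * (δ ^ 2 + y ^ 2)⁻¹ := by
  have h1 := norm_conj_imagResolvent_sub_le hδ ha hspec u hu y
  have h2 := norm_conj_imagResolvent_sub_le hδ ha hspec u hu (-y)
  rw [neg_sq] at h2
  rw [cfc_div_sq_add_sq hδ ha hspec, mul_smul_comm, smul_mul_assoc, ← smul_sub, norm_smul,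
    mul_add, add_mul, add_sub_add_comm]
  have h3 := (norm_add_le _ _).trans (add_le_add h1 h2)
  have : ‖(1 / 2 : ℂ)‖ = 1 / 2 := by norm_num
  rw [this]
  linarith

open MeasureTheory in
theorem norm_conj_cfc_sign_sub_le (hδ : 0 < δ) (ha : IsSelfAdjoint a)
    (hspec : ∀ x ∈ spectrum ℝ a, δ ≤ |x|) (u : Aˣ) (hu : ‖u * a * ↑u⁻¹ - a‖ < δ) :
    ‖u * cfc Real.sign a * ↑u⁻¹ - cfc Real.sign a‖ ≤
      ‖u * a * ↑u⁻¹ - a‖ / (δ - ‖u * a * ↑u⁻¹ - a‖) := by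
  obtain ⟨hint, heq⟩ := integrable_cfc_div_sq_add_sq_and_integral hδ ha hspec
  let L : A →L[ℝ] A :=
    ContinuousLinearMap.mulLeftRight ℝ A (u : A) (↑u⁻¹ : A) - ContinuousLinearMap.id ℝ A
  have hL (b : A) : L b = u * b * ↑u⁻¹ - b := rfl
  have hcomm := L.integral_comp_comm hint
  rw [heq, map_smul] at hcomm
  simp only [hL] at hcomm
  have hle := norm_integral_le_of_norm_le
    ((integrable_inv_sq_add_sq hδ.ne').const_mul _)
    (.of_forall (norm_conj_cfc_div_sq_add_sq_sub_le hδ ha hspec u hu))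
  have hval : ∫ y : ℝ, (δ ^ 2 + y ^ 2)⁻¹ = Real.pi / δ := by
    have := integral_univ_div_sq_add_sq hδ.ne'
    simp_rw [div_eq_mul_inv] at this
    rw [integral_const_mul, Real.sign_of_pos hδ, mul_one] at this
    rw [eq_div_iff hδ.ne', mul_comm, this]
  rw [hcomm, integral_const_mul, hval, norm_smul, Real.norm_of_nonneg Real.pi_pos.le] at hle
  refine le_of_mul_le_mul_left (hle.trans_eq ?_) Real.pi_pos
  field_simp

end CStarAlgebra


/-- Let `D` be bounded self-adjoint with spectrum disjoint from `(−δ, δ)`,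
`δ > 0`, `Λ⁺ := (1/2)(1 + sgn D)`. Let `W` be a bounded invertible operator and
`K := W D W⁻¹ − D`. If `‖K‖ < δ`, then `‖W Λ⁺ W⁻¹ − Λ⁺‖ ≤ ‖K‖ / (2(δ − ‖K‖))`. -/
theorem conjugated_projection_bound
    {H : Type*} [NormedAddCommGroup H] [InnerProductSpace ℂ H] [CompleteSpace H]
    (δ : ℝ) (hδ : 0 < δ)
    (D : H →L[ℂ] H) (hD : IsSelfAdjoint D)
    (hspec : ∀ x ∈ spectrum ℝ D, x ∉ Set.Ioo (-δ) δ)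
    (W : (H →L[ℂ] H)ˣ)
    (K : H →L[ℂ] H)
    (hK : K = (W : H →L[ℂ] H) ∘L D ∘L ((W⁻¹ : (H →L[ℂ] H)ˣ) : H →L[ℂ] H) - D)
    (hKδ : ‖K‖ < δ) :
    ‖(W : H →L[ℂ] H) ∘L ((1 / 2 : ℂ) • (1 + cfc Real.sign D)) ∘L
          ((W⁻¹ : (H →L[ℂ] H)ˣ) : H →L[ℂ] H)
        - (1 / 2 : ℂ) • (1 + cfc Real.sign D)‖
      ≤ ‖K‖ / (2 * (δ - ‖K‖)) := by
  have hspec' : ∀ x ∈ spectrum ℝ D, δ ≤ |x| := fun x hx ↦ by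
    by_contra! h
    exact hspec x hx (abs_lt.1 h)
  have hK' : K = W * D * ↑W⁻¹ - D := hK
  rw [hK'] at hKδ ⊢
  have h := norm_conj_cfc_sign_sub_le hδ hD hspec' W hKδ
  have hhalf : (W : H →L[ℂ] H) ∘L ((1 / 2 : ℂ) • (1 + cfc Real.sign D)) ∘L
        ((W⁻¹ : (H →L[ℂ] H)ˣ) : H →L[ℂ] H) - (1 / 2 : ℂ) • (1 + cfc Real.sign D) =
      (1 / 2 : ℂ) • (W * cfc Real.sign D * ↑W⁻¹ - cfc Real.sign D) := by
    change (W : H →L[ℂ] H) * ((1 / 2 : ℂ) • (1 + cfc Real.sign D)) * ↑W⁻¹ - _ = _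
    rw [mul_smul_comm, smul_mul_assoc, ← smul_sub, mul_add, mul_one, add_mul, Units.mul_inv,
      add_sub_add_left_eq_sub]
  have hnorm : ‖(1 / 2 : ℂ)‖ = 1 / 2 := by norm_num
  rw [hhalf, norm_smul, hnorm, mul_comm 2, ← div_div]
  linarith
end

section
/- Let H be a complex Hilbert space, δ > 0, and let D be a bounded self-adjoint operator on H whose spectrum is disjoint from (−δ, δ); set Λ⁺ := (1/2)(1 + sgn(D)). Then for every λ ≥ δ and every ψ ∈ H one has ‖ψ − Λ⁺ψ‖ ≤ ‖(D − λ)ψ‖ / (λ + δ). In particular, if (ψ_n) is a sequence of unit vectors with ‖(D − λ)ψ_n‖ → 0, then ‖Λ⁺ψ_n‖ → 1 as n → ∞. -/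
open Filter

/-- The sign function is continuous on every set that avoids `0`. -/
lemma continuousOn_sign_of_ne_zero {s : Set ℝ} (hs : ∀ x ∈ s, x ≠ 0) :
    ContinuousOn Real.sign s := by
  intro x hx
  apply ContinuousAt.continuousWithinAt
  rcases lt_or_gt_of_ne (hs x hx) with h | h
  · refine (continuousAt_const (y := (-1 : ℝ))).congr ?_
    filter_upwards [Iio_mem_nhds h] with y hy using (Real.sign_of_neg hy).symm
  · refine (continuousAt_const (y := (1 : ℝ))).congr ?_
    filter_upwards [Ioi_mem_nhds h] with y hy using (Real.sign_of_pos hy).symm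

/-- If the spectrum of `a` avoids `(-δ, δ)`, the negative spectral projection of `a` factors
through `a - r` with a left factor of norm at most `(r + δ)⁻¹`. -/
lemma exists_mul_sub_eq_half_one_sub_sign {A : Type*} [CStarAlgebra A] {δ : ℝ} (hδ : 0 < δ)
    {a : A} (ha : IsSelfAdjoint a) (hspec : ∀ x ∈ spectrum ℝ a, x ∉ Set.Ioo (-δ) δ)
    {r : ℝ} (hr : δ ≤ r) :
    ∃ b : A, ‖b‖ ≤ (r + δ)⁻¹ ∧
      b * (a - algebraMap ℝ A r) = (1 / 2 : ℝ) • (1 - cfc Real.sign a) := by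
  have hrδ : 0 < r + δ := by linarith
  have hne : ∀ x ∈ spectrum ℝ a, x ≠ 0 := by
    rintro x hx rfl
    exact hspec 0 hx ⟨by linarith, hδ⟩
  have hsign : ContinuousOn Real.sign (spectrum ℝ a) := continuousOn_sign_of_ne_zero hne
  have hden : ∀ x : ℝ, |x| + r ≠ 0 := fun x =>
    (add_pos_of_nonneg_of_pos (abs_nonneg x) (hδ.trans_le hr)).ne'
  let g : ℝ → ℝ := fun x => -((1 / 2) * (1 - Real.sign x)) / (|x| + r)
  have hg : ContinuousOn g (spectrum ℝ a) :=
    ((continuousOn_const.mul (continuousOn_const.sub hsign)).neg).div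
      (by fun_prop) (fun x _ => hden x)
  refine ⟨cfc g a, norm_cfc_le (by positivity) fun x hx => ?_, ?_⟩
  · rcases lt_or_gt_of_ne (hne x hx) with h | h
    · have hx' : x ≤ -δ := by
        by_contra! h'
        exact hspec x hx ⟨h', by linarith⟩
      have hgx : g x = -(r - x)⁻¹ := by
        simp only [g, Real.sign_of_neg h, abs_of_neg h]
        rw [show -x + r = r - x by ring]
        ring
      rw [hgx, norm_neg, norm_inv, Real.norm_of_nonneg (by linarith)]
      exact inv_anti₀ (by linarith) (by linarith)
    · have hgx : g x = 0 := by simp [g, Real.sign_of_pos h]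
      rw [hgx, norm_zero]
      positivity
  · have hsub : a - algebraMap ℝ A r = cfc (fun x : ℝ => x - r) a := by
      rw [cfc_sub (fun x : ℝ => x) (fun _ => r) a, cfc_id' ℝ a, cfc_const r a]
    have hproj : (1 / 2 : ℝ) • (1 - cfc Real.sign a)
        = cfc (fun x : ℝ => (1 / 2 : ℝ) • (1 - Real.sign x)) a := by
      rw [cfc_smul (1 / 2 : ℝ) (fun x => 1 - Real.sign x) a (continuousOn_const.sub hsign),
        cfc_sub (fun _ : ℝ => (1 : ℝ)) Real.sign a continuousOn_const hsign, cfc_const_one ℝ a]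
    rw [hsub, hproj, ← cfc_mul g (fun x : ℝ => x - r) a hg (by fun_prop)]
    refine cfc_congr fun x hx => ?_
    rcases lt_or_gt_of_ne (hne x hx) with h | h
    · have := hden x
      rw [abs_of_neg h] at this
      simp only [g, Real.sign_of_neg h, abs_of_neg h, smul_eq_mul]
      field_simp
      ring
    · simp [g, Real.sign_of_pos h]

/-- Let `D` be bounded self-adjoint with spectrum disjoint from `(−δ, δ)`,
`δ > 0`, and `Λ⁺ := (1/2)(1 + sgn D)`. Then for `λ ≥ δ` and `ψ ∈ H`:
`‖ψ − Λ⁺ψ‖ ≤ ‖(D − λ)ψ‖/(λ + δ)`. In particular, for any sequence of unit vectors `ψₙ` with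
`‖(D − λ)ψₙ‖ → 0` one has `‖Λ⁺ψₙ‖ → 1`. -/
theorem weyl_sequence_positive_subspace
    {H : Type*} [NormedAddCommGroup H] [InnerProductSpace ℂ H] [CompleteSpace H]
    (δ : ℝ) (hδ : 0 < δ)
    (D : H →L[ℂ] H) (hD : IsSelfAdjoint D)
    (hspec : ∀ x ∈ spectrum ℝ D, x ∉ Set.Ioo (-δ) δ) :
    (∀ lam : ℝ, δ ≤ lam → ∀ ψ : H,
      ‖ψ - ((1 / 2 : ℂ) • (1 + cfc Real.sign D)) ψ‖
        ≤ ‖(D - (lam : ℂ) • (1 : H →L[ℂ] H)) ψ‖ / (lam + δ)) ∧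
    (∀ lam : ℝ, δ ≤ lam → ∀ ψ : ℕ → H, (∀ n, ‖ψ n‖ = 1) →
      Tendsto (fun n => ‖(D - (lam : ℂ) • (1 : H →L[ℂ] H)) (ψ n)‖) atTop (nhds 0) →
      Tendsto (fun n => ‖((1 / 2 : ℂ) • (1 + cfc Real.sign D)) (ψ n)‖) atTop (nhds 1)) := by
  have hbound : ∀ lam : ℝ, δ ≤ lam → ∀ ψ : H,
      ‖ψ - ((1 / 2 : ℂ) • (1 + cfc Real.sign D)) ψ‖
        ≤ ‖(D - (lam : ℂ) • (1 : H →L[ℂ] H)) ψ‖ / (lam + δ) := by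
    intro lam hlam ψ
    obtain ⟨b, hb, hbD⟩ := exists_mul_sub_eq_half_one_sub_sign hδ hD hspec hlam
    have hscalar : algebraMap ℝ (H →L[ℂ] H) lam = (lam : ℂ) • (1 : H →L[ℂ] H) := by
      rw [Algebra.algebraMap_eq_smul_one, Complex.coe_smul]
    have hhalf : (1 / 2 : ℝ) • (1 - cfc Real.sign D)
        = (1 : H →L[ℂ] H) - (1 / 2 : ℂ) • (1 + cfc Real.sign D) := by
      rw [← Complex.coe_smul]
      push_cast
      module
    rw [hscalar, hhalf] at hbD
    have hψ : ψ - ((1 / 2 : ℂ) • (1 + cfc Real.sign D)) ψ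
        = b ((D - (lam : ℂ) • (1 : H →L[ℂ] H)) ψ) :=
      (DFunLike.congr_fun hbD ψ).symm
    rw [hψ, div_eq_inv_mul]
    exact b.le_of_opNorm_le hb _
  refine ⟨hbound, fun lam hlam ψ hψ hlim => ?_⟩
  rw [tendsto_iff_norm_sub_tendsto_zero]
  refine squeeze_zero (fun _ => norm_nonneg _) (fun n => ?_)
    (by simpa using hlim.div_const (lam + δ))
  refine le_trans ?_ (hbound lam hlam (ψ n))
  rw [← hψ n, norm_sub_rev (ψ n)]
  exact abs_norm_sub_norm_le _ _
end
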